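/- There is an absolute constant C > 0 such that for every prime p, the Heilbronn subgroup Γ := { m^p : m ∈ Z/p²Z, m not divisible by p } ⊆ Z/p²Z satisfies E₃(Γ) ≤ C · p³ · log p. -/

import Mathlib

open Finset

open scoped Classical in
/-- `(A ∘ A)(x)` = number of pairs `(a, a') ∈ A × A` with `a' - a = x`. -/
noncomputable def convAA {n : ℕ} (A : Finset (ZMod n)) (x : ZMod n) : ℕ :=
  (A.filter fun a => a + x ∈ A).card

/-- Third energy `E₃(A) = Σ_x (A ∘ A)(x)³`. -/
noncomputable def energy3 {n : ℕ} [NeZero n] (A : Finset (ZMod n)) : ℕ :=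
  ∑ x : ZMod n, (convAA A x) ^ 3

open scoped Classical in
/-- Heilbronn's subgroup `Γ = { m^p : m ∈ Z/p²Z, p ∤ m } ⊆ Z/p²Z`. -/
noncomputable def heilbronnSubgroup (p : ℕ) [NeZero (p ^ 2)] : Finset (ZMod (p ^ 2)) :=
  Finset.univ.filter fun x : ZMod (p ^ 2) => ∃ m : ZMod (p ^ 2), ¬ p ∣ m.val ∧ m ^ p = x

open Polynomial

/-- A system of homogeneous linear equations with fewer equations than unknowns has a nonzero
solution. -/
theorem exists_ne_zero_forall_sum_mul_eq_zero {K ι κ : Type*} [Field K] [Fintype ι] [Fintype κ]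
    (M : ι → κ → K) (h : Fintype.card κ < Fintype.card ι) :
    ∃ v : ι → K, v ≠ 0 ∧ ∀ j, ∑ i, v i * M i j = 0 := by
  classical
  have hker := LinearMap.ker_ne_bot_of_finrank_lt (f := Matrix.mulVecLin (Matrix.of M).transpose)
    (by simpa using h)
  obtain ⟨v, hv, hv0⟩ := Submodule.exists_mem_ne_zero_of_ne_bot hker
  refine ⟨v, hv0, fun j => ?_⟩
  have := congrFun (LinearMap.mem_ker.1 hv) j
  simpa [Matrix.vecMul, dotProduct] using this

section Stepanov

variable {p : ℕ} [hp : Fact p.Prime] {F : (ZMod p)[X]}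

/-- The polynomial `∑ a, (1 + X) ^ a * q a (F)`. -/
noncomputable def logSum (F : (ZMod p)[X]) {A : ℕ} (q : Fin A → (ZMod p)[X]) : (ZMod p)[X] :=
  ∑ a : Fin A, (1 + X) ^ (a : ℕ) * (q a).comp F

theorem one_add_X_mul_derivative_pow (a : ℕ) :
    (1 + X) * derivative ((1 + X : (ZMod p)[X]) ^ a) = (a : (ZMod p)[X]) * (1 + X) ^ a := by
  rcases a with _ | a
  · simp
  · rw [derivative_pow_succ]
    simp
    ring

theorem pow_dvd_logSum (hF : X * (1 + X) * derivative F = X - X ^ p) {A n : ℕ} (hn : n < p)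
    (q : Fin A → (ZMod p)[X]) (c : ℕ) (h : X ^ (n + 1) ∣ logSum F q) :
    X ^ n ∣ logSum F fun a => derivative (q a) + ((a : ℕ) - c : (ZMod p)[X]) * q a := by
  have hF' : (1 + X) * derivative F = 1 - X ^ (p - 1) := by
    apply mul_left_cancel₀ (X_ne_zero (R := ZMod p))
    rw [← mul_assoc, hF, mul_sub, mul_one, ← pow_succ', Nat.sub_add_cancel hp.out.one_le]
  have key : logSum F (fun a => derivative (q a) + ((a : ℕ) - c : (ZMod p)[X]) * q a) =
      (1 + X) * derivative (logSum F q) - (c : (ZMod p)[X]) * logSum F q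
        + X ^ (p - 1) * logSum F fun a => derivative (q a) := by
    simp only [logSum, derivative_sum, mul_sum, ← sum_sub_distrib, ← sum_add_distrib]
    refine sum_congr rfl fun a _ => ?_
    rw [derivative_mul, derivative_comp]
    have := one_add_X_mul_derivative_pow (p := p) (a : ℕ)
    simp only [add_comp, mul_comp, sub_comp, natCast_comp]
    linear_combination (-(q a).comp F) * this
      - (1 + X) ^ (a : ℕ) * (derivative (q a)).comp F * hF'
  rw [key]
  refine dvd_add (dvd_sub (Dvd.dvd.mul_left ?_ _) (Dvd.dvd.mul_left ?_ _)) (Dvd.dvd.mul_right ?_ _)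
  · simpa using pow_sub_one_dvd_derivative_of_pow_dvd h
  · exact (pow_dvd_pow _ n.le_succ).trans h
  · exact pow_dvd_pow _ (by omega)

open scoped Classical in
theorem not_X_pow_dvd_logSum (hF : X * (1 + X) * derivative F = X - X ^ p) {A : ℕ} (hA : A ≤ p)
    {n : ℕ} (hn : n ≤ p) (q : Fin A → (ZMod p)[X]) (hq : q ≠ 0)
    (hw : ∑ a, (if q a = 0 then 0 else (q a).natDegree + 1) ≤ n) : ¬ X ^ n ∣ logSum F q := by
  induction n generalizing q with
  | zero =>
    refine (hq ?_).elim
    funext a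
    have := (Finset.sum_eq_zero_iff.1 (Nat.le_zero.1 hw)) a (mem_univ a)
    by_contra h
    simp_all
  | succ n ih =>
    intro hdvd
    obtain ⟨c, hc⟩ := Function.ne_iff.1 hq
    have hc : q c ≠ 0 := hc
    have hstep := pow_dvd_logSum hF (by omega) q c hdvd
    have hdeg : (q c).natDegree < p := by
      have := single_le_sum (f := fun a => if q a = 0 then 0 else (q a).natDegree + 1)
        (fun _ _ => Nat.zero_le _) (mem_univ c)
      simp only [hc, if_false] at this
      omega
    set r : Fin A → (ZMod p)[X] :=
      fun a => derivative (q a) + ((a : ℕ) - (c : ℕ) : (ZMod p)[X]) * q a with hr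
    have hrc : r c = derivative (q c) := by simp [hr]
    have hscal : ∀ a, a ≠ c → (((a : ℕ) : ZMod p) - ((c : ℕ) : ZMod p)) ≠ 0 := by
      intro a hac h
      rw [sub_eq_zero, ZMod.natCast_eq_natCast_iff'] at h
      rw [Nat.mod_eq_of_lt (by omega), Nat.mod_eq_of_lt (by omega)] at h
      exact hac (Fin.ext h)
    have hra : ∀ a, r a = derivative (q a) + C (((a : ℕ) : ZMod p) - ((c : ℕ) : ZMod p)) * q a := by
      intro a; simp [hr]
    by_cases hr0 : r = 0
    · have hq0 : ∀ a, a ≠ c → q a = 0 := by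
        intro a hac
        by_contra hqa
        have h1 := (hra a).symm.trans (congrFun hr0 a)
        have h2 : degree (C (((a : ℕ) : ZMod p) - ((c : ℕ) : ZMod p)) * q a) = degree (q a) := by
          rw [degree_mul, degree_C (hscal a hac), zero_add]
        rw [Pi.zero_apply, add_eq_zero_iff_eq_neg] at h1
        have h3 := degree_derivative_lt hqa
        rw [h1, degree_neg, h2] at h3
        exact lt_irrefl _ h3
      have hconst : (q c).natDegree = 0 := by
        by_contra h0
        have h1 : derivative (q c) = 0 := hrc.symm.trans (congrFun hr0 c)
        have h2 : (derivative (q c)).coeff ((q c).natDegree - 1) = 0 := by simp [h1]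
        rw [coeff_derivative, Nat.sub_add_cancel (Nat.pos_of_ne_zero h0), coeff_natDegree] at h2
        rcases mul_eq_zero.1 h2 with h2 | h2
        · exact hc (leadingCoeff_eq_zero.1 h2)
        · rw [← Nat.cast_succ, Nat.succ_eq_add_one, Nat.sub_add_cancel (Nat.pos_of_ne_zero h0),
            ZMod.natCast_eq_zero_iff] at h2
          exact h0 (Nat.eq_zero_of_dvd_of_lt h2 hdeg)
      obtain ⟨u, hu⟩ := natDegree_eq_zero.1 hconst
      have hsum : logSum F q = (1 + X) ^ (c : ℕ) * C u := by
        rw [logSum, Finset.sum_eq_single c]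
        · rw [← hu, C_comp]
        · intro a _ hac
          simp [hq0 a hac]
        · simp
      rw [hsum] at hdvd
      have h1 := ((dvd_pow_self X n.succ_ne_zero).trans hdvd)
      rw [X_dvd_iff, coeff_zero_eq_eval_zero] at h1
      simp only [eval_mul, eval_pow, eval_add, eval_one, eval_X, add_zero, one_pow, one_mul,
        eval_C] at h1
      exact hc (by rw [← hu, h1, C_0])
    · refine ih (by omega) r hr0 ?_ hstep
      refine Nat.le_of_lt_succ
        (lt_of_lt_of_le (Finset.sum_lt_sum (fun a _ => ?_) ⟨c, mem_univ c, ?_⟩) hw)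
      · by_cases hqa : q a = 0
        · simp [hra, hqa]
        · simp only [hqa, if_false]
          split_ifs
          · omega
          · have h1 : (r a).natDegree ≤ (q a).natDegree := by
              rw [hra]
              refine natDegree_add_le_of_degree_le ((natDegree_derivative_le _).trans (by omega)) ?_
              exact natDegree_C_mul_le _ _
            omega
      · simp only [hc, if_false]
        split_ifs with h
        · omega
        · rw [hrc] at h ⊢
          have h1 := natDegree_lt_natDegree h (degree_derivative_lt hc)
          omega

/-- The auxiliary polynomial of Stepanov's method. -/
noncomputable def auxPoly (F : (ZMod p)[X]) {A B N : ℕ} (v : Fin A × Fin B × Fin N → ZMod p) :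
    (ZMod p)[X] :=
  ∑ i, C (v i) * ((1 + X) ^ (i.1 : ℕ) * F ^ (i.2.1 : ℕ) * X ^ (p * (i.2.2 : ℕ)))

theorem auxPoly_ne_zero (hF : X * (1 + X) * derivative F = X - X ^ p) {A B N : ℕ}
    (hA : A ≤ p) (hAB : A * B ≤ p) (v : Fin A × Fin B × Fin N → ZMod p) (hv : v ≠ 0) :
    auxPoly F v ≠ 0 := by
  classical
  set q : Fin N → Fin A → (ZMod p)[X] :=
    fun c a => ∑ b : Fin B, C (v (a, b, c)) * X ^ (b : ℕ) with hq
  have hcoeff : ∀ c a (b : Fin B), (q c a).coeff b = v (a, b, c) := by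
    intro c a b
    simp only [hq, finsetSum_coeff, coeff_C_mul, coeff_X_pow]
    rw [Finset.sum_eq_single b]
    · simp
    · intro b' _ hb
      rw [if_neg (fun h => hb (Fin.ext h.symm)), mul_zero]
    · simp
  have hsum : auxPoly F v = ∑ c : Fin N, X ^ (p * (c : ℕ)) * logSum F (q c) := by
    simp only [auxPoly, Fintype.sum_prod_type, logSum, hq, Polynomial.sum_comp, mul_sum]
    rw [Finset.sum_comm (s := (univ : Finset (Fin N)))]
    refine sum_congr rfl fun a _ => ?_
    rw [Finset.sum_comm]
    refine sum_congr rfl fun c _ => sum_congr rfl fun b _ => ?_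
    simp only [mul_comp, C_comp, pow_comp, X_comp]
    ring
  have hex : ∃ c : ℕ, ∃ h : c < N, q ⟨c, h⟩ ≠ 0 := by
    by_contra! h
    refine hv (funext fun ⟨a, b, c⟩ => ?_)
    rw [← hcoeff, h c c.2]
    simp
  obtain ⟨hc, hqc⟩ := Nat.find_spec hex
  have hmin : ∀ c : Fin N, (c : ℕ) < Nat.find hex → q c = 0 := by
    intro c h
    have := Nat.find_min hex h
    push Not at this
    exact this c.2
  set c₀ := Nat.find hex
  intro h0
  refine not_X_pow_dvd_logSum hF hA le_rfl (q ⟨c₀, hc⟩) hqc ?_ ?_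
  · calc _ ≤ ∑ a : Fin A, B := by
          refine sum_le_sum fun a _ => ?_
          split_ifs with h
          · exact Nat.zero_le _
          · refine (natDegree_lt_iff_degree_lt h).2 ?_
            refine (degree_sum_le _ _).trans_lt
              ((Finset.sup_lt_iff (WithBot.bot_lt_coe B)).2 fun b _ => ?_)
            exact (degree_C_mul_X_pow_le _ _).trans_lt (WithBot.coe_lt_coe.2 b.2)
      _ ≤ p := by simpa using hAB
  · have h1 : X ^ (p * c₀) * X ^ p ∣ X ^ (p * c₀) * logSum F (q ⟨c₀, hc⟩) := by
      have h2 : X ^ (p * c₀) * logSum F (q ⟨c₀, hc⟩) =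
          - ∑ c ∈ univ.erase (⟨c₀, hc⟩ : Fin N), X ^ (p * (c : ℕ)) * logSum F (q c) := by
        rw [eq_neg_iff_add_eq_zero]
        exact (Finset.add_sum_erase _ (fun c : Fin N => X ^ (p * (c : ℕ)) * logSum F (q c))
          (mem_univ _)).trans (hsum.symm.trans h0)
      rw [h2, dvd_neg]
      refine dvd_sum fun c hcm => ?_
      rcases lt_or_ge (c : ℕ) c₀ with hlt | hge
      · have : logSum F (q c) = 0 := by
          rw [hmin c hlt]
          simp [logSum]
        simp [this]
      · refine Dvd.dvd.mul_right ?_ _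
        rw [← pow_add, ← mul_add_one]
        refine pow_dvd_pow _ (Nat.mul_le_mul_left _ ?_)
        have : (c : ℕ) ≠ c₀ := fun h => (Finset.ne_of_mem_erase hcm) (Fin.ext h)
        omega
    exact (mul_dvd_mul_iff_left (pow_ne_zero _ X_ne_zero)).1 h1

/-- The differential operator `X (1 + X) d/dX`. -/
noncomputable def eulerDeriv (g : (ZMod p)[X]) : (ZMod p)[X] :=
  X * (1 + X) * derivative g

theorem eulerDeriv_iterate_sum {ι : Type*} (s : Finset ι) (u : ι → ZMod p) (g : ι → (ZMod p)[X])
    (n : ℕ) :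
    eulerDeriv^[n] (∑ i ∈ s, C (u i) * g i) = ∑ i ∈ s, C (u i) * eulerDeriv^[n] (g i) := by
  induction n generalizing g with
  | zero => rfl
  | succ n ih =>
    rw [Function.iterate_succ_apply]
    have : eulerDeriv (∑ i ∈ s, C (u i) * g i) = ∑ i ∈ s, C (u i) * eulerDeriv (g i) := by
      simp only [eulerDeriv, derivative_sum, derivative_C_mul, mul_sum]
      exact sum_congr rfl fun i _ => by ring
    rw [this, ih]
    rfl

theorem eval_eulerDeriv_iterate (x : ZMod p) (m : ℕ) (g : (ZMod p)[X]) :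
    (eulerDeriv^[m] ((X - C x) ^ m * g)).eval x = m.factorial * (x * (1 + x)) ^ m * g.eval x := by
  induction m generalizing g with
  | zero => simp
  | succ m ih =>
    have : eulerDeriv ((X - C x) ^ (m + 1) * g) =
        (X - C x) ^ m *
          (((m + 1 : ℕ) : (ZMod p)[X]) * (X * (1 + X)) * g + (X - C x) * eulerDeriv g) := by
      simp only [eulerDeriv, derivative_mul, derivative_pow_succ]
      simp
      ring
    rw [Function.iterate_succ_apply, this, ih, Nat.factorial_succ]
    simp
    ring

theorem X_sub_C_pow_dvd {x : ZMod p} (hx : x * (1 + x) ≠ 0) {D : ℕ} (hD : D ≤ p) {g : (ZMod p)[X]}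
    (h : ∀ n < D, (eulerDeriv^[n] g).eval x = 0) : (X - C x) ^ D ∣ g := by
  by_cases hg : g = 0
  · simp [hg]
  rw [← le_rootMultiplicity_iff hg]
  by_contra! hlt
  obtain ⟨r, hr, hrx⟩ := exists_eq_pow_rootMultiplicity_mul_and_not_dvd g hg x
  have h0 := h _ hlt
  set m := rootMultiplicity x g
  rw [hr, eval_eulerDeriv_iterate] at h0
  rw [dvd_iff_isRoot, IsRoot.def] at hrx
  have hm : ((m.factorial : ℕ) : ZMod p) ≠ 0 := by
    rw [Ne, ZMod.natCast_eq_zero_iff, hp.out.dvd_factorial]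
    omega
  exact mul_ne_zero (mul_ne_zero hm (pow_ne_zero _ hx)) hrx h0

theorem exists_polynomial_eval_eulerDeriv (hF : X * (1 + X) * derivative F = X - X ^ p)
    (k : ZMod p) (n a b c : ℕ) : ∃ P : (ZMod p)[X], P.natDegree ≤ a + c + n ∧
      ∀ x, F.eval x = k →
        (eulerDeriv^[n] ((1 + X) ^ a * F ^ b * X ^ (p * c))).eval x = P.eval x := by
  induction n generalizing a b c with
  | zero =>
    refine ⟨(1 + X) ^ a * C (k ^ b) * X ^ c, ?_, fun x hx => ?_⟩
    · compute_degree!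
    · simp [hx, pow_mul, ZMod.pow_card]
  | succ n ih =>
    obtain ⟨P₁, hd₁, h₁⟩ := ih (a + 1) b c
    obtain ⟨P₂, hd₂, h₂⟩ := ih a b c
    obtain ⟨P₃, hd₃, h₃⟩ := ih (a + 1) (b - 1) c
    obtain ⟨P₄, hd₄, h₄⟩ := ih a (b - 1) c
    obtain ⟨P₅, hd₅, h₅⟩ := ih a (b - 1) (c + 1)
    refine ⟨C (a : ZMod p) * P₁ + C (-a : ZMod p) * P₂ + C (b : ZMod p) * P₃
      + C (-b : ZMod p) * P₄ + C (-b : ZMod p) * P₅, ?_, fun x hx => ?_⟩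
    · have (u : ZMod p) {P : (ZMod p)[X]} (hP : P.natDegree ≤ a + c + (n + 1)) :
          (C u * P).natDegree ≤ a + c + (n + 1) := (natDegree_C_mul_le _ _).trans hP
      exact natDegree_add_le_of_degree_le (natDegree_add_le_of_degree_le
        (natDegree_add_le_of_degree_le (natDegree_add_le_of_degree_le (this _ (by omega))
        (this _ (by omega))) (this _ (by omega))) (this _ (by omega))) (this _ (by omega))
    · have key : eulerDeriv ((1 + X) ^ a * F ^ b * X ^ (p * c)) =
          ∑ i : Fin 5, C (![(a : ZMod p), -a, b, -b, -b] i) *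
            ![(1 + X) ^ (a + 1) * F ^ b * X ^ (p * c), (1 + X) ^ a * F ^ b * X ^ (p * c),
              (1 + X) ^ (a + 1) * F ^ (b - 1) * X ^ (p * c),
              (1 + X) ^ a * F ^ (b - 1) * X ^ (p * c),
              (1 + X) ^ a * F ^ (b - 1) * X ^ (p * (c + 1))] i := by
        have hX : derivative ((X : (ZMod p)[X]) ^ (p * c)) = 0 := by
          simp [derivative_X_pow]
        have hU := one_add_X_mul_derivative_pow (p := p) a
        have hFb : derivative (F ^ b) = (b : (ZMod p)[X]) * F ^ (b - 1) * derivative F := by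
          rw [derivative_pow, C_eq_natCast]
        rw [eulerDeriv, derivative_mul, hX, derivative_mul, hFb]
        simp [Fin.sum_univ_five]
        linear_combination (X * F ^ b * X ^ (p * c)) * hU
          + ((1 + X) ^ a * b * F ^ (b - 1) * X ^ (p * c)) * hF
      rw [Function.iterate_succ_apply, key, eulerDeriv_iterate_sum]
      simp [Fin.sum_univ_five, h₁ x hx, h₂ x hx, h₃ x hx, h₄ x hx, h₅ x hx]

theorem natDegree_auxPoly_le (hdeg : F.natDegree ≤ p) {A B N : ℕ}
    (v : Fin A × Fin B × Fin N → ZMod p) : (auxPoly F v).natDegree ≤ A + p * (B + N) := by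
  refine natDegree_sum_le_of_forall_le _ _ fun i _ => (natDegree_C_mul_le _ _).trans ?_
  refine natDegree_mul_le.trans ?_
  rw [natDegree_X_pow]
  have h1 : ((1 + X : (ZMod p)[X]) ^ (i.1 : ℕ) * F ^ (i.2.1 : ℕ)).natDegree ≤ A + B * p := by
    refine natDegree_mul_le_of_le ?_ ?_
    · refine (natDegree_pow_le_of_le (m := 1) _ (by compute_degree!)).trans ?_
      have := i.1.2
      omega
    · exact (natDegree_pow_le_of_le _ hdeg).trans (Nat.mul_le_mul_right _ i.2.1.2.le)
  have h2 := Nat.mul_le_mul_left p i.2.2.2.le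
  linarith

theorem mul_card_le_of_eval_mem (hF : X * (1 + X) * derivative F = X - X ^ p)
    (hdeg : F.natDegree ≤ p) {A B N D : ℕ} (hA : A ≤ p) (hAB : A * B ≤ p) (hD : D ≤ p)
    (S Q : Finset (ZMod p)) (hQ : ∀ x ∈ Q, x * (1 + x) ≠ 0) (hQS : ∀ x ∈ Q, F.eval x ∈ S)
    (hcard : #S * (D * (A + N + D)) < A * (B * N)) : D * #Q ≤ A + p * (B + N) := by
  choose P hPdeg hP using exists_polynomial_eval_eulerDeriv hF
  obtain ⟨v, hv0, hv⟩ := exists_ne_zero_forall_sum_mul_eq_zero (K := ZMod p)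
    (ι := Fin A × Fin B × Fin N) (κ := S × Fin D × Fin (A + N + D))
    (fun i j => (P j.1 j.2.1 i.1 i.2.1 i.2.2).coeff j.2.2) (by simpa using hcard)
  have hvan : ∀ k ∈ S, ∀ n < D, ∑ i, C (v i) * P k n i.1 i.2.1 i.2.2 = 0 := by
    intro k hk n hn
    ext m
    rw [finsetSum_coeff, coeff_zero]
    by_cases hm : m < A + N + D
    · simpa using hv (⟨k, hk⟩, ⟨n, hn⟩, ⟨m, hm⟩)
    · refine Finset.sum_eq_zero fun i _ => ?_
      rw [coeff_C_mul, coeff_eq_zero_of_natDegree_lt, mul_zero]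
      refine (hPdeg _ _ _ _ _).trans_lt ?_
      have := i.1.2
      have := i.2.2.2
      omega
  have hdvd : ∏ x ∈ Q, (X - C x) ^ D ∣ auxPoly F v := by
    refine Finset.prod_dvd_of_coprime (fun x _ y _ hxy => ?_) fun x hx => ?_
    · exact (pairwise_coprime_X_sub_C Function.injective_id hxy).pow
    · refine X_sub_C_pow_dvd (hQ x hx) hD fun n hn => ?_
      have h1 := congrArg (eval x) (hvan _ (hQS x hx) n hn)
      rw [auxPoly, eulerDeriv_iterate_sum, eval_finsetSum]
      rw [eval_finsetSum, eval_zero] at h1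
      rw [← h1]
      refine sum_congr rfl fun i _ => ?_
      rw [eval_mul, eval_mul, hP _ _ _ _ _ x rfl]
  refine le_trans ?_ ((natDegree_le_of_dvd hdvd (auxPoly_ne_zero hF hA hAB v hv0)).trans
    (natDegree_auxPoly_le hdeg v))
  rw [natDegree_prod _ _ fun x _ => pow_ne_zero _ (X_sub_C_ne_zero x)]
  simp [mul_comm]

/-- Stepanov's bound: a set of points of `ZMod p` on which `F` takes `R` values has size
`O((p * R) ^ (2 / 3))`. -/
theorem card_pow_three_le (hF : X * (1 + X) * derivative F = X - X ^ p)
    (hdeg : F.natDegree ≤ p) (Q : Finset (ZMod p)) (hQ : ∀ x ∈ Q, x * (1 + x) ≠ 0) :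
    #Q ^ 3 ≤ 72000 * p ^ 2 * #(Q.image fun x => F.eval x) ^ 2 := by
  set S := Q.image fun x => F.eval x
  rcases Q.eq_empty_or_nonempty with rfl | hne
  · simp
  have hR : 0 < #S := (hne.image _).card_pos
  set R := #S
  have hp0 := hp.out.pos
  rcases le_or_gt p (576 * R ^ 2) with hsmall | hlarge
  · have h1 : #Q ≤ p := (card_le_univ Q).trans_eq (ZMod.card p)
    calc #Q ^ 3 ≤ p ^ 3 := Nat.pow_le_pow_left h1 3
      _ = p ^ 2 * p := by ring
      _ ≤ p ^ 2 * (576 * R ^ 2) := Nat.mul_le_mul_left _ hsmall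
      _ ≤ 72000 * p ^ 2 * R ^ 2 := by
        have : 0 ≤ p ^ 2 * R ^ 2 := Nat.zero_le _
        linarith
  have hex : ∃ n, 3 * R * p < n ^ 3 := 
    ⟨3 * R * p + 1, (Nat.lt_succ_self _).trans_le (Nat.le_self_pow three_ne_zero _)⟩
  obtain ⟨B, hB, hBle⟩ : ∃ B, 3 * R * p < B ^ 3 ∧ B ^ 3 ≤ 24 * R * p := by
    refine ⟨Nat.find hex, Nat.find_spec hex, ?_⟩
    have hspec := Nat.find_spec hex
    have hmin := @Nat.find_min _ _ hex (Nat.find hex - 1)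
    set B := Nat.find hex
    have hRp : 1 ≤ R * p := Nat.mul_pos hR hp0
    have hB2 : 2 ≤ B := by
      by_contra! h
      have : B ^ 3 ≤ 1 ^ 3 := Nat.pow_le_pow_left (by omega) 3
      nlinarith
    have h1 := not_lt.1 (hmin (by omega))
    calc B ^ 3 ≤ (2 * (B - 1)) ^ 3 := Nat.pow_le_pow_left (by omega) 3
      _ = 8 * (B - 1) ^ 3 := by ring
      _ ≤ 24 * R * p := by linarith
  have hB0 : 0 < B := Nat.pos_of_ne_zero (by rintro rfl; simp at hB)
  have hB6 : (B ^ 2) ^ 3 ≤ 576 * R ^ 2 * p ^ 2 := by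
    calc (B ^ 2) ^ 3 = (B ^ 3) ^ 2 := by ring
      _ ≤ (24 * R * p) ^ 2 := Nat.pow_le_pow_left hBle 2
      _ = 576 * R ^ 2 * p ^ 2 := by ring
  have hBp : B ^ 2 < p := by
    refine lt_of_pow_lt_pow_left₀ 3 hp0.le (hB6.trans_lt ?_)
    calc 576 * R ^ 2 * p ^ 2 < p * p ^ 2 := Nat.mul_lt_mul_of_pos_right hlarge (by positivity)
      _ = p ^ 3 := by ring
  obtain ⟨A, hAp, hpA⟩ : ∃ A, A * B ≤ p ∧ p < (A + 1) * B :=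
    ⟨p / B, Nat.div_mul_le_self p B, by
      have := Nat.lt_div_mul_add hB0 (a := p)
      linarith⟩
  have hBA : B ≤ A := by
    by_contra! h
    nlinarith [Nat.mul_le_mul_right B (Nat.succ_le_of_lt h)]
  have hA : A ≤ p := by nlinarith
  have hA0 : 0 < A := hB0.trans_le hBA
  have h3 : 3 * R * A < B ^ 2 := by
    refine lt_of_mul_lt_mul_right (a := B) ?_ (Nat.zero_le _)
    nlinarith [Nat.mul_le_mul_left (3 * R) hAp]
  have hcard : #S * (A * (A + B + A)) < A * (B * B) := by
    have : R * (A + B + A) < B * B := by nlinarith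
    nlinarith
  have hmain := mul_card_le_of_eval_mem hF hdeg hA hAp hA S Q hQ
    (fun x hx => mem_image_of_mem _ hx) hcard
  have hQB : #Q ≤ 5 * B ^ 2 := by
    refine le_of_mul_le_mul_left (a := A) ?_ hA0
    have h4 : p ≤ 2 * (A * B) := by nlinarith
    nlinarith [Nat.mul_le_mul_right (B + B) h4, Nat.mul_le_mul_left A (Nat.mul_pos hB0 hB0)]
  calc #Q ^ 3 ≤ (5 * B ^ 2) ^ 3 := Nat.pow_le_pow_left hQB 3
    _ = 125 * (B ^ 2) ^ 3 := by ring
    _ ≤ 72000 * p ^ 2 * R ^ 2 := by linarith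

end Stepanov

/-- If the fibres of `h` over any set of `R` values contain `O(R ^ (2 / 3))` points in total, then
the third moment of the fibre sizes is at most logarithmic. -/
theorem sum_card_fiber_pow_three_le {α β : Type*} [DecidableEq β] [Fintype β] (T : Finset α)
    (h : α → β) (K P : ℕ) (hP : #T ≤ P) (hK : ∀ Q ⊆ T, #Q ^ 3 ≤ K * #(Q.image h) ^ 2) :
    (∑ w, (#{y ∈ T | h y = w} : ℝ) ^ 3) ≤ 3 * K * (1 + Real.log P) := by
  set M : β → ℕ := fun w => #{y ∈ T | h y = w}
  have hMP : ∀ w, M w ≤ P := fun w => (card_filter_le _ _).trans hP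
  have hcube : ∀ N : ℕ, (N : ℝ) ^ 3 ≤ ∑ j ∈ Icc 1 N, 3 * (j : ℝ) ^ 2 := by
    intro N
    induction N with
    | zero => simp
    | succ N ih =>
      rw [sum_Icc_succ_top (by omega)]
      push_cast
      nlinarith [(Nat.cast_nonneg N : (0 : ℝ) ≤ N)]
  have hlevel : ∀ j ∈ Icc 1 P, 3 * (j : ℝ) ^ 2 * #{w | j ≤ M w} ≤ 3 * K * (j : ℝ)⁻¹ := by
    intro j hj
    have hj1 := (mem_Icc.1 hj).1
    have hj0 : (0 : ℝ) < j := by exact_mod_cast hj1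
    set W : Finset β := {w | j ≤ M w}
    have h1 : j * #W ≤ #{y ∈ T | h y ∈ W} := by
      rw [card_eq_sum_card_fiberwise (s := {y ∈ T | h y ∈ W}) (t := W) (f := h)
          fun y hy => mem_coe.2 (mem_filter.1 (mem_coe.1 hy)).2,
        mul_comm, ← smul_eq_mul]
      refine card_nsmul_le_sum _ _ _ fun w hw => ((mem_filter.1 hw).2).trans (card_le_card ?_)
      intro y hy
      obtain ⟨hyT, rfl⟩ := mem_filter.1 hy
      exact mem_filter.2 ⟨mem_filter.2 ⟨hyT, hw⟩, rfl⟩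
    have h2 : #({y ∈ T | h y ∈ W}.image h) ≤ #W :=
      card_le_card (image_subset_iff.2 fun y hy => (mem_filter.1 hy).2)
    have h3 : (j * #W) ^ 3 ≤ K * #W ^ 2 :=
      (Nat.pow_le_pow_left h1 3).trans ((hK _ (filter_subset _ _)).trans
        (Nat.mul_le_mul_left _ (Nat.pow_le_pow_left h2 2)))
    have h4 : j ^ 3 * #W ≤ K := by
      rcases Nat.eq_zero_or_pos #W with h0 | h0
      · simp [h0]
      · refine le_of_mul_le_mul_right (a := #W ^ 2) ?_ (by positivity)
        calc j ^ 3 * #W * #W ^ 2 = (j * #W) ^ 3 := by ring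
          _ ≤ _ := h3
    have h5 : (j : ℝ) ^ 3 * #W ≤ K := by exact_mod_cast h4
    rw [← div_eq_mul_inv, le_div_iff₀ hj0]
    linarith
  calc ∑ w, (M w : ℝ) ^ 3 ≤ ∑ w, ∑ j ∈ Icc 1 (M w), 3 * (j : ℝ) ^ 2 :=
        sum_le_sum fun w _ => hcube _
    _ = ∑ j ∈ Icc 1 P, ∑ w with j ≤ M w, 3 * (j : ℝ) ^ 2 := by
        refine sum_comm' fun w j => ?_
        have := hMP w
        simp only [mem_univ, mem_Icc, mem_filter, true_and]
        omega
    _ = ∑ j ∈ Icc 1 P, 3 * (j : ℝ) ^ 2 * #{w | j ≤ M w} := by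
        refine sum_congr rfl fun j _ => ?_
        rw [sum_const, nsmul_eq_mul, mul_comm]
    _ ≤ ∑ j ∈ Icc 1 P, 3 * K * (j : ℝ)⁻¹ := sum_le_sum hlevel
    _ = 3 * K * (harmonic P : ℝ) := by
        rw [← mul_sum, harmonic_eq_sum_Icc]
        push_cast
        rfl
    _ ≤ 3 * K * (1 + Real.log P) :=
        mul_le_mul_of_nonneg_left (harmonic_le_one_add_log P) (by positivity)

section Heilbronn

variable (p : ℕ) [hp : Fact p.Prime]

/-- Reduction from `ZMod (p ^ 2)` to `ZMod p`. -/
def reduction : ZMod (p ^ 2) →+* ZMod p :=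
  ZMod.castHom (dvd_pow_self p two_ne_zero) (ZMod p)

/-- The map `t ↦ (t + 1) ^ p - t ^ p` from `ZMod p` to `ZMod (p ^ 2)`. -/
def powDiff (y : ZMod p) : ZMod (p ^ 2) :=
  ((y.val : ZMod (p ^ 2)) + 1) ^ p - (y.val : ZMod (p ^ 2)) ^ p

theorem exists_fermatQuotientPoly : ∃ G : ℤ[X], (1 + X) ^ p - X ^ p - 1 = C (p : ℤ) * G := by
  refine (C_dvd_iff_dvd_coeff _ _).2 fun i => ?_
  have h : ((1 + X : ℤ[X]) ^ p - X ^ p - 1).map (Int.castRingHom (ZMod p)) = 0 := by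
    simp [add_pow_char]
  have h1 := congrArg (fun g => coeff g i) h
  simp only [coeff_map, coeff_zero] at h1
  exact (ZMod.intCast_zmod_eq_zero_iff_dvd _ p).1 h1

theorem card_pow_three_le_card_image_powDiff (Q : Finset (ZMod p))
    (hQ : ∀ x ∈ Q, x * (1 + x) ≠ 0) :
    #Q ^ 3 ≤ 72000 * p ^ 2 * #(Q.image (powDiff p)) ^ 2 := by
  obtain ⟨G, hG⟩ := exists_fermatQuotientPoly p
  have hp0 : (p : ℤ) ≠ 0 := by exact_mod_cast hp.out.ne_zero
  set F := G.map (Int.castRingHom (ZMod p)) with hFdef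
  have hder : derivative G = (1 + X) ^ (p - 1) - X ^ (p - 1) := by
    have h1 := congrArg derivative hG
    simp only [derivative_sub, derivative_pow, derivative_add, derivative_one, derivative_X,
      derivative_C_mul, zero_add, mul_one, sub_zero] at h1
    refine mul_left_cancel₀ (C_ne_zero.2 hp0) (h1.symm.trans ?_)
    simp [mul_sub]
  have hF : X * (1 + X) * derivative F = X - X ^ p := by
    have h1 : derivative F = (1 + X) ^ (p - 1) - X ^ (p - 1) := by
      rw [hFdef, derivative_map, hder]
      simp
    have h2 : (1 + X : (ZMod p)[X]) * (1 + X) ^ (p - 1) = 1 + X ^ p := by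
      rw [← pow_succ', Nat.sub_add_cancel hp.out.one_le, add_pow_char, one_pow]
    have h3 : (X : (ZMod p)[X]) * X ^ (p - 1) = X ^ p := by
      rw [← pow_succ', Nat.sub_add_cancel hp.out.one_le]
    rw [h1]
    linear_combination X * h2 - (1 + X) * h3
  have hdeg : F.natDegree ≤ p := by
    refine natDegree_map_le.trans ?_
    rw [← natDegree_C_mul hp0, ← hG]
    compute_degree!
  refine (card_pow_three_le hF hdeg Q hQ).trans
    (Nat.mul_le_mul_left _ (Nat.pow_le_pow_left ?_ 2))
  have hval : ∀ y : ZMod p, powDiff p y - 1 = ((p * G.eval (y.val : ℤ) : ℤ) : ZMod (p ^ 2)) := by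
    intro y
    have h1 := congrArg (eval (y.val : ℤ)) hG
    simp only [eval_sub, eval_pow, eval_add, eval_one, eval_X, eval_mul, eval_C] at h1
    rw [← h1, powDiff]
    push_cast
    ring
  have hfac : ∀ x y, powDiff p x = powDiff p y → F.eval x = F.eval y := by
    intro x y hxy
    have h1 := (hval x).symm.trans ((congrArg (· - 1) hxy).trans (hval y))
    rw [ZMod.intCast_eq_intCast_iff_dvd_sub, ← mul_sub] at h1
    push_cast at h1
    rw [pow_two] at h1
    have h2 := (ZMod.intCast_eq_intCast_iff_dvd_sub _ _ p).2 (Int.dvd_of_mul_dvd_mul_left hp0 h1)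
    have h3 : ∀ z : ZMod p, F.eval z = ((G.eval (z.val : ℤ) : ℤ) : ZMod p) := by
      intro z
      conv_lhs => rw [← ZMod.natCast_zmod_val z]
      rw [hFdef, ← Int.cast_natCast, ← eq_intCast (Int.castRingHom (ZMod p)), eval_map_apply]
      rfl
    rw [h3, h3, h2]
  have himage : (Q.image fun x => F.eval x) =
      (Q.image (powDiff p)).image (Function.extend (powDiff p) (fun x => F.eval x) 0) := by
    rw [image_image]
    refine image_congr fun x _ => ?_
    exact (Function.FactorsThrough.extend_apply (fun x y h => hfac x y h) _ x).symm
  rw [himage]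
  exact card_image_le

variable {p}

theorem pow_eq_pow_of_reduction_eq {u v : ZMod (p ^ 2)} (h : reduction p u = reduction p v) :
    u ^ p = v ^ p := by
  have h1 : (p : ZMod (p ^ 2)) ∣ u - v := by
    have h2 : reduction p (u - v) = 0 := by rw [map_sub, h, sub_self]
    obtain ⟨n, hn⟩ := ZMod.natCast_zmod_surjective (u - v)
    rw [← hn] at h2 ⊢
    rw [map_natCast, ZMod.natCast_eq_zero_iff] at h2
    exact_mod_cast Nat.cast_dvd_cast h2
  have h3 := dvd_sub_pow_of_dvd_sub h1 1
  have h4 : ((p : ZMod (p ^ 2)) ^ (1 + 1)) = 0 := by exact_mod_cast ZMod.natCast_self (p ^ 2)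
  rw [h4, zero_dvd_iff, pow_one, sub_eq_zero] at h3
  exact h3

theorem reduction_pow (u : ZMod (p ^ 2)) : reduction p (u ^ p) = reduction p u := by
  rw [map_pow, ZMod.pow_card]

theorem isUnit_of_reduction_ne_zero {u : ZMod (p ^ 2)} (h : reduction p u ≠ 0) : IsUnit u := by
  obtain ⟨n, rfl⟩ := ZMod.natCast_zmod_surjective u
  rw [map_natCast, Ne, ZMod.natCast_eq_zero_iff] at h
  rw [ZMod.isUnit_iff_coprime]
  exact Nat.Coprime.pow_right 2 ((Nat.Prime.coprime_iff_not_dvd hp.out).2 h).symm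

theorem pow_eq_self_of_mem_heilbronnSubgroup {a : ZMod (p ^ 2)} (ha : a ∈ heilbronnSubgroup p) :
    a ^ p = a ∧ reduction p a ≠ 0 := by
  obtain ⟨m, hm, rfl⟩ := (mem_filter.1 ha).2
  refine ⟨pow_eq_pow_of_reduction_eq (reduction_pow m), ?_⟩
  rw [reduction_pow, ← ZMod.natCast_zmod_val m, map_natCast, Ne, ZMod.natCast_eq_zero_iff]
  exact hm

theorem reduction_injOn_heilbronnSubgroup :
    Set.InjOn (reduction p) (heilbronnSubgroup p : Set (ZMod (p ^ 2))) := by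
  intro a ha b hb hab
  rw [← (pow_eq_self_of_mem_heilbronnSubgroup ha).1,
    ← (pow_eq_self_of_mem_heilbronnSubgroup hb).1, pow_eq_pow_of_reduction_eq hab]

theorem card_heilbronnSubgroup_le : #(heilbronnSubgroup p) ≤ p := by
  refine (card_le_card_of_injOn (t := univ) (reduction p) (fun _ _ => mem_coe.2 (mem_univ _))
    reduction_injOn_heilbronnSubgroup).trans_eq ?_
  rw [card_univ, ZMod.card]

theorem convAA_eq_zero {x : ZMod (p ^ 2)} (hx : reduction p x = 0) (hx0 : x ≠ 0) :
    convAA (heilbronnSubgroup p) x = 0 := by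
  refine card_eq_zero.2 (filter_eq_empty_iff.2 fun a ha hax => hx0 ?_)
  have := reduction_injOn_heilbronnSubgroup hax ha (by rw [map_add, hx, add_zero])
  simpa using this

theorem convAA_le {x : ZMod (p ^ 2)} (hx : reduction p x ≠ 0) :
    convAA (heilbronnSubgroup p) x ≤
      #{y ∈ ({y | y * (1 + y) ≠ 0} : Finset (ZMod p)) | powDiff p y = x * (x ^ p)⁻¹} := by
  have hs : IsUnit (x ^ p) := (isUnit_of_reduction_ne_zero hx).pow p
  set s := (x ^ p)⁻¹
  have hxs : x ^ p * s = 1 := ZMod.mul_inv_of_unit _ hs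
  have hrs : reduction p x * reduction p s = 1 := by
    rw [← reduction_pow x, ← map_mul, hxs, map_one]
  have hsp : s ^ p = s := by
    have h1 : x ^ p * s ^ p = 1 := by
      rw [← pow_eq_pow_of_reduction_eq (reduction_pow x), ← mul_pow, hxs, one_pow]
    exact hs.mul_left_cancel (h1.trans hxs.symm)
  have hs0 : reduction p s ≠ 0 := right_ne_zero_of_mul_eq_one hrs
  refine card_le_card_of_injOn (fun a => reduction p (a * s)) (fun a ha => ?_) ?_
  · obtain ⟨ha, hax⟩ := mem_filter.1 (mem_coe.1 ha)
    obtain ⟨hap, ha0⟩ := pow_eq_self_of_mem_heilbronnSubgroup ha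
    obtain ⟨haxp, hax0⟩ := pow_eq_self_of_mem_heilbronnSubgroup hax
    have hadd : 1 + reduction p (a * s) = reduction p ((a + x) * s) := by
      rw [add_mul, map_add, map_mul _ x, hrs, add_comm]
    refine mem_coe.2 (mem_filter.2 ⟨mem_filter.2 ⟨mem_univ _, ?_⟩, ?_⟩)
    · change reduction p (a * s) * (1 + reduction p (a * s)) ≠ 0
      rw [hadd, map_mul, map_mul]
      exact mul_ne_zero (mul_ne_zero ha0 hs0) (mul_ne_zero hax0 hs0)
    · have h1 : reduction p (((reduction p (a * s)).val : ZMod (p ^ 2))) = reduction p (a * s) := by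
        rw [map_natCast, ZMod.natCast_zmod_val]
      rw [powDiff, pow_eq_pow_of_reduction_eq h1,
        pow_eq_pow_of_reduction_eq (v := (a + x) * s)
          (by rw [map_add, h1, map_one, ← hadd, add_comm]),
        mul_pow, mul_pow, hap, haxp, hsp]
      ring
  · intro a ha b hb hab
    refine reduction_injOn_heilbronnSubgroup (mem_filter.1 (mem_coe.1 ha)).1
      (mem_filter.1 (mem_coe.1 hb)).1 ?_
    simp only [map_mul] at hab
    exact mul_right_cancel₀ hs0 hab

theorem card_fiber_le (w : ZMod (p ^ 2)) :
    #{x ∈ ({x | reduction p x ≠ 0} : Finset (ZMod (p ^ 2))) | x * (x ^ p)⁻¹ = w} ≤ p := by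
  refine (card_le_card_of_injOn (t := univ) (reduction p) (fun _ _ => mem_coe.2 (mem_univ _))
    ?_).trans_eq (by rw [card_univ, ZMod.card])
  have key : ∀ x : ZMod (p ^ 2), reduction p x ≠ 0 → x * (x ^ p)⁻¹ = w → x = w * x ^ p := by
    rintro x hx rfl
    rw [mul_assoc, ZMod.inv_mul_of_unit _ ((isUnit_of_reduction_ne_zero hx).pow p), mul_one]
  intro x hx y hy hxy
  simp only [coe_filter, mem_filter, mem_univ, true_and, Set.mem_ofPred_eq] at hx hy
  rw [key x hx.1 hx.2, key y hy.1 hy.2, pow_eq_pow_of_reduction_eq hxy]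

end Heilbronn

/-- There is an absolute constant `C > 0` such that for every prime `p`, the
Heilbronn subgroup `Γ = { m^p : m ∈ Z/p²Z, p ∤ m }` satisfies `E₃(Γ) ≤ C · p³ · log p`. -/
theorem stmt15 :
    ∃ C : ℝ, 0 < C ∧
      ∀ (p : ℕ) [Fact p.Prime],
        (energy3 (heilbronnSubgroup p) : ℝ) ≤ C * (p : ℝ) ^ (3 : ℕ) * Real.log p := by
  refine ⟨648002, by norm_num, fun p hp => ?_⟩
  set Γ := heilbronnSubgroup p
  set T : Finset (ZMod p) := {y | y * (1 + y) ≠ 0}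
  set M : ZMod (p ^ 2) → ℕ := fun w => #{y ∈ T | powDiff p y = w}
  have hmoment : ∑ w, (M w : ℝ) ^ 3 ≤ 3 * (72000 * p ^ 2 : ℕ) * (1 + Real.log p) :=
    sum_card_fiber_pow_three_le T (powDiff p) _ p ((card_le_univ T).trans_eq (ZMod.card p))
      fun Q hQ => card_pow_three_le_card_image_powDiff p Q fun x hx => (mem_filter.1 (hQ hx)).2
  have hzero : ∑ x with ¬ reduction p x ≠ 0, (convAA Γ x) ^ 3 ≤ p ^ 3 := by
    rw [Finset.sum_eq_single_of_mem 0 (by simp)]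
    · exact Nat.pow_le_pow_left ((card_filter_le _ _).trans card_heilbronnSubgroup_le) 3
    · intro x hx hx0
      rw [convAA_eq_zero (not_not.1 (mem_filter.1 hx).2) hx0, zero_pow three_ne_zero]
  have hunit : ∑ x with reduction p x ≠ 0, (convAA Γ x) ^ 3 ≤ p * ∑ w, M w ^ 3 := by
    calc ∑ x with reduction p x ≠ 0, (convAA Γ x) ^ 3
        ≤ ∑ x with reduction p x ≠ 0, M (x * (x ^ p)⁻¹) ^ 3 :=
          sum_le_sum fun x hx => Nat.pow_le_pow_left (convAA_le (mem_filter.1 hx).2) 3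
      _ = ∑ w, ∑ x ∈ ({x | reduction p x ≠ 0} : Finset (ZMod (p ^ 2))) with x * (x ^ p)⁻¹ = w,
            M (x * (x ^ p)⁻¹) ^ 3 := (sum_fiberwise _ _ _).symm
      _ ≤ ∑ w, p * M w ^ 3 := by
          refine sum_le_sum fun w _ => ?_
          rw [sum_congr rfl fun x hx => by rw [(mem_filter.1 hx).2], sum_const, smul_eq_mul]
          exact Nat.mul_le_mul_right _ (card_fiber_le w)
      _ = p * ∑ w, M w ^ 3 := by rw [mul_sum]
  have henergy : energy3 Γ ≤ p ^ 3 + p * ∑ w, M w ^ 3 := by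
    rw [energy3, ← sum_filter_add_sum_filter_not univ fun x => reduction p x ≠ 0, add_comm]
    exact add_le_add hzero hunit
  have hlog : 1 ≤ 2 * Real.log p := by
    have h1 : Real.log 2 ≤ Real.log p :=
      Real.log_le_log two_pos (by exact_mod_cast hp.out.two_le)
    linarith [Real.log_two_gt_d9]
  calc (energy3 Γ : ℝ) ≤ p ^ 3 + p * ∑ w, (M w : ℝ) ^ 3 := by exact_mod_cast henergy
    _ ≤ p ^ 3 + p * (3 * (72000 * p ^ 2 : ℕ) * (1 + Real.log p)) := by gcongr
    _ = p ^ 3 * (1 + 216000 * (1 + Real.log p)) := by push_cast; ring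
    _ ≤ p ^ 3 * (648002 * Real.log p) := by gcongr; linarith
    _ = 648002 * (p : ℝ) ^ 3 * Real.log p := by ring
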